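/- Under the stated setup, let S_u be a solo D-pair such that u and ū have no common neighbor and such that no edge between S_u and V∖S has f-weight equal to 1/2. If w̄₁ or w̄₂ has all three of its neighbors in S (degree 3 in G[S]), then {w₁, w₂} is not a constraint pair of S_u. -/

import Mathlib

open Finset

/-- `m` encodes a perfect matching of the induced subgraph `G[S]`:
every vertex of `S` is matched to a distinct adjacent vertex of `S`. -/
def IsMatchingOn {V : Type*} (G : SimpleGraph V) (S : Finset V) (m : V → V) : Prop :=
  ∀ u ∈ S, m u ∈ S ∧ m u ≠ u ∧ G.Adj u (m u) ∧ m (m u) = u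

/-- `S` is a paired dominating set of `G`: a dominating set such that `G[S]`
has a perfect matching. -/
def IsPDS {V : Type*} (G : SimpleGraph V) (S : Finset V) : Prop :=
  (∀ v : V, v ∉ S → ∃ u ∈ S, G.Adj v u) ∧ ∃ m : V → V, IsMatchingOn G S m

/-- The paired domination number of `G`. -/
noncomputable def gammaPr {V : Type*} (G : SimpleGraph V) : ℕ :=
  sInf {k : ℕ | ∃ S : Finset V, IsPDS G S ∧ S.card = k}

/-- `N_S(x)`, the set of neighbours of `x` inside `S`. -/
def nbrS {V : Type*} [DecidableEq V] (G : SimpleGraph V) [DecidableRel G.Adj]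
    (S : Finset V) (x : V) : Finset V :=
  S.filter (fun u => G.Adj x u)

/-- `λ(S)`: (twice) the number of edges of `G[S]` (each edge counted in both directions). -/
def lambdaS {V : Type*} [DecidableEq V] (G : SimpleGraph V) [DecidableRel G.Adj]
    (S : Finset V) : ℕ :=
  ((S ×ˢ S).filter (fun p => G.Adj p.1 p.2)).card

/-- The private neighbours of `u ∈ S`: vertices outside `S` whose unique
neighbour in `S` is `u`. -/
def privates {V : Type*} [Fintype V] [DecidableEq V] (G : SimpleGraph V) [DecidableRel G.Adj]
    (S : Finset V) (u : V) : Finset V :=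
  Finset.univ.filter (fun x => x ∉ S ∧ nbrS G S x = {u})

/-- `A = {v ∈ S : v and v̄ together have at least two private neighbours}`. -/
def setA {V : Type*} [Fintype V] [DecidableEq V] (G : SimpleGraph V) [DecidableRel G.Adj]
    (S : Finset V) (m : V → V) : Finset V :=
  S.filter (fun v => 2 ≤ (privates G S v).card + (privates G S (m v)).card)

/-- `B = {v ∈ S : v has a private neighbour and v̄ has none}`. -/
def setB {V : Type*} [Fintype V] [DecidableEq V] (G : SimpleGraph V) [DecidableRel G.Adj]
    (S : Finset V) (m : V → V) : Finset V :=
  S.filter (fun v => (privates G S v).Nonempty ∧ privates G S (m v) = ∅)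

/-- `C = {v ∈ S : v̄ ∈ B}`. -/
def setC {V : Type*} [Fintype V] [DecidableEq V] (G : SimpleGraph V) [DecidableRel G.Adj]
    (S : Finset V) (m : V → V) : Finset V :=
  S.filter (fun v => m v ∈ setB G S m)

/-- `D = {v ∈ S : neither v nor v̄ has a private neighbour}`. -/
def setD {V : Type*} [Fintype V] [DecidableEq V] (G : SimpleGraph V) [DecidableRel G.Adj]
    (S : Finset V) (m : V → V) : Finset V :=
  S.filter (fun v => privates G S v = ∅ ∧ privates G S (m v) = ∅)

/-- The weight `f(xu)` of an edge `xu` with `x ∈ V∖S` and `u ∈ S`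
(`0` on non-edges and on pairs not of this form). -/
def fwt {V : Type*} [Fintype V] [DecidableEq V] (G : SimpleGraph V) [DecidableRel G.Adj]
    (S : Finset V) (m : V → V) (x u : V) : ℚ :=
  if x ∈ S ∨ u ∉ S ∨ ¬ G.Adj x u then 0
  else if nbrS G S x = {u} then 1
  else if nbrS G S x ⊆ setA G S m ∨ nbrS G S x ⊆ setB G S m ∪ setC G S m ∨
      nbrS G S x ⊆ setD G S m then
    1 / ((nbrS G S x).card : ℚ)
  else if u ∈ setA G S m then 0
  else if nbrS G S x ∩ setD G S m = ∅ then
    1 / (((nbrS G S x ∩ (setB G S m ∪ setC G S m))).card : ℚ)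
  else if u ∈ setB G S m ∪ setC G S m then 1 / 6
  else (1 - ((nbrS G S x ∩ (setB G S m ∪ setC G S m)).card : ℚ) / 6) /
      ((nbrS G S x ∩ setD G S m).card : ℚ)

/-- `f(S')`: total weight of the edges between `S' ⊆ S` and `V∖S`. -/
def fsum {V : Type*} [Fintype V] [DecidableEq V] (G : SimpleGraph V) [DecidableRel G.Adj]
    (S : Finset V) (m : V → V) (T : Finset V) : ℚ :=
  ∑ u ∈ T, ∑ x ∈ Finset.univ \ S, fwt G S m x u

/-- `C` is (the vertex set of) a connected component of `G[S]`. -/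
def IsComponent {V : Type*} [DecidableEq V] (G : SimpleGraph V) [DecidableRel G.Adj]
    (S C : Finset V) : Prop :=
  C ⊆ S ∧ C.Nonempty ∧ (G.induce (↑C : Set V)).Connected ∧
    ∀ u ∈ C, ∀ v ∈ S, G.Adj u v → v ∈ C

/-- `S_u = {u, m u}` is a `D`-pair. -/
def IsDPair {V : Type*} [Fintype V] [DecidableEq V] (G : SimpleGraph V) [DecidableRel G.Adj]
    (S : Finset V) (m : V → V) (u : V) : Prop :=
  u ∈ setD G S m ∧ m u ∈ setD G S m

/-- `S_u = {u, m u}` is an `A`-pair. -/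
def IsAPair {V : Type*} [Fintype V] [DecidableEq V] (G : SimpleGraph V) [DecidableRel G.Adj]
    (S : Finset V) (m : V → V) (u : V) : Prop :=
  u ∈ setA G S m ∧ m u ∈ setA G S m

/-- `S_u = {u, m u}` is a `BC`-pair. -/
def IsBCPair {V : Type*} [Fintype V] [DecidableEq V] (G : SimpleGraph V) [DecidableRel G.Adj]
    (S : Finset V) (m : V → V) (u : V) : Prop :=
  (u ∈ setB G S m ∧ m u ∈ setC G S m) ∨ (u ∈ setC G S m ∧ m u ∈ setB G S m)

/-- `u` is a leaf of `G[S]`: it has exactly one neighbour in `S`. -/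
def IsLeaf {V : Type*} [DecidableEq V] (G : SimpleGraph V) [DecidableRel G.Adj]
    (S : Finset V) (u : V) : Prop :=
  (nbrS G S u).card = 1

/-- `S_u` is a solo pair: both `u` and `m u` are leaves of `G[S]`. -/
def IsSoloPair {V : Type*} [DecidableEq V] (G : SimpleGraph V) [DecidableRel G.Adj]
    (S : Finset V) (m : V → V) (u : V) : Prop :=
  IsLeaf G S u ∧ IsLeaf G S (m u)

/-- The component `C` of `G[S]` contains no linked `D`-pairs: no edge of `G[S]`
joins vertices of two distinct `D`-pairs. -/
def NoLinkedDPairs {V : Type*} [Fintype V] [DecidableEq V] (G : SimpleGraph V)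
    [DecidableRel G.Adj] (S : Finset V) (m : V → V) (C : Finset V) : Prop :=
  ∀ u ∈ C, ∀ v ∈ C, u ∈ setD G S m → v ∈ setD G S m → v ≠ u → v ≠ m u → ¬ G.Adj u v

/-- `{w₁, w₂}` is a constraint pair of the solo `D`-pair `S_u`. -/
def ConstraintPair {V : Type*} [Fintype V] [DecidableEq V] (G : SimpleGraph V)
    [DecidableRel G.Adj] (S : Finset V) (m : V → V) (u w₁ w₂ : V) : Prop :=
  ∃ x y : V, x ∉ S ∧ y ∉ S ∧ G.Adj u y ∧ G.Adj (m u) x ∧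
    G.Adj x w₁ ∧ G.Adj y w₂ ∧ w₁ ∈ setD G S m ∧ w₂ ∈ setD G S m ∧
    w₁ ≠ w₂ ∧ m w₁ ≠ w₂

/-- The pairs `S_u` and `S_v` are adjacent: some vertex of one is adjacent
to some vertex of the other. -/
def PairAdj {V : Type*} (G : SimpleGraph V) (m : V → V) (u v : V) : Prop :=
  G.Adj u v ∨ G.Adj u (m v) ∨ G.Adj (m u) v ∨ G.Adj (m u) (m v)

/-- The Petersen graph, as the Kneser graph on 2-element subsets of a
5-element set, two subsets being adjacent iff they are disjoint. -/
def petersenGraph : SimpleGraph {s : Finset (Fin 5) // s.card = 2} where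
  Adj a b := Disjoint (a : Finset (Fin 5)) (b : Finset (Fin 5))
  symm := ⟨fun _ _ h => Disjoint.symm h⟩
  loopless := by
    refine ⟨?_⟩
    intro a h
    rw [disjoint_self] at h
    have h2 := a.2
    rw [h] at h2
    simp at h2

/-- One-sided version: `y` is an outside neighbour of `a` and of `w ∈ D`, where `m w` has all
its neighbours in `S`; then `S \ {m a, w, m w} ∪ {y}` is a smaller paired dominating set. -/
lemma one_sided_aux {V : Type*} [Fintype V] [DecidableEq V]
    (G : SimpleGraph V) [DecidableRel G.Adj] (S : Finset V) (m : V → V)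
    (hcubic : ∀ v : V, G.degree v = 3)
    (hdom : ∀ v : V, v ∉ S → ∃ u ∈ S, G.Adj v u)
    (hmatch : IsMatchingOn G S m)
    (hmincard : ∀ T : Finset V, IsPDS G T → S.card ≤ T.card)
    (a w y : V) (ha : a ∈ setD G S m)
    (hla : (nbrS G S a).card = 1) (hlb : (nbrS G S (m a)).card = 1)
    (hf : ∀ x : V, x ∉ S → G.Adj x (m a) → fwt G S m x (m a) ≠ 1/2)
    (hw : w ∈ setD G S m) (h3 : (nbrS G S (m w)).card = 3)
    (hy : y ∉ S) (hay : G.Adj a y) (hyw : G.Adj y w) : False := by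
  have haS : a ∈ S := (mem_filter.1 ha).1
  have hwS : w ∈ S := (mem_filter.1 hw).1
  obtain ⟨-, hpa, hpb⟩ := mem_filter.1 ha
  obtain ⟨-, hpw, hpw'⟩ := mem_filter.1 hw
  obtain ⟨hbS, hba, hab, hmb⟩ := hmatch a haS
  obtain ⟨hcS, hcw, hwc, hmc⟩ := hmatch w hwS
  have hbD : m a ∈ setD G S m := by
    simp only [setD, mem_filter]; exact ⟨hbS, hpb, by rw [hmb]; exact hpa⟩
  have hwa : w ≠ a := by rintro rfl; omega
  have hwb : w ≠ m a := by rintro rfl; rw [hmb] at h3; omega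
  have hcb : m w ≠ m a := fun h => hwa (by rw [← hmc, h, hmb])
  have hca : m w ≠ a := fun h => hwb (by rw [← hmc, h])
  -- neighbours of `m w` lie in `S`
  have hcN : ∀ v, G.Adj (m w) v → v ∈ S := by
    intro v hv
    have hsub : nbrS G S (m w) ⊆ G.neighborFinset (m w) := by
      intro z hz
      rw [SimpleGraph.mem_neighborFinset]
      exact (mem_filter.1 hz).2
    have heq := eq_of_subset_of_card_le hsub (by
      rw [SimpleGraph.card_neighborFinset_eq_degree, hcubic, h3])
    have : v ∈ nbrS G S (m w) := by
      rw [heq, SimpleGraph.mem_neighborFinset]; exact hv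
    exact (mem_filter.1 this).1
  -- the only `S`-neighbour of `m a` is `a`
  have hbN : ∀ v ∈ S, G.Adj (m a) v → v = a := by
    intro v hv hadj
    obtain ⟨z, hz⟩ := card_eq_one.1 hlb
    have h1 : v ∈ nbrS G S (m a) := mem_filter.2 ⟨hv, hadj⟩
    have h2 : a ∈ nbrS G S (m a) := mem_filter.2 ⟨haS, hab.symm⟩
    rw [hz, mem_singleton] at h1 h2
    rw [h1, h2]
  have hsub3 : ({m a, w, m w} : Finset V) ⊆ S := by
    intro z hz
    simp only [mem_insert, mem_singleton] at hz
    rcases hz with rfl | rfl | rfl <;> assumption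
  have hcard3 : ({m a, w, m w} : Finset V).card = 3 :=
    card_eq_three.2 ⟨_, _, _, hwb.symm, hcb.symm, hcw.symm, rfl⟩
  set T : Finset V := insert y (S \ {m a, w, m w}) with hT
  have memT : ∀ v, v ∈ T ↔ v = y ∨ (v ∈ S ∧ v ≠ m a ∧ v ≠ w ∧ v ≠ m w) := by
    intro v; simp [hT]
  have hTcard : T.card < S.card := by
    have h1 := card_insert_le y (S \ {m a, w, m w})
    have h2 := card_sdiff_add_card_eq_card hsub3
    rw [← hT] at h1
    omega
  refine absurd (hmincard T ⟨?_, ?_⟩) (by omega)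
  · intro v hv
    by_cases hvb : v = m a
    · exact ⟨a, (memT a).2 (Or.inr ⟨haS, hba.symm, hwa.symm, hca.symm⟩), hvb ▸ hab.symm⟩
    by_cases hvw : v = w
    · exact ⟨y, (memT y).2 (Or.inl rfl), hvw ▸ hyw.symm⟩
    by_cases hvc : v = m w
    · obtain ⟨z, hz, hzw⟩ := exists_mem_ne (s := nbrS G S (m w)) (by omega) w
      obtain ⟨hzS, hz⟩ := mem_filter.1 hz
      refine ⟨z, (memT z).2 (Or.inr ⟨hzS, ?_, hzw, hz.ne'⟩), hvc ▸ hz⟩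
      rintro rfl
      exact hca (hbN _ hcS hz.symm)
    have hvS : v ∉ S := fun h => hv ((memT v).2 (Or.inr ⟨h, hvb, hvw, hvc⟩))
    by_contra hno
    push Not at hno
    have hsub : ∀ z ∈ nbrS G S v, z = m a ∨ z = w := by
      intro z hz
      obtain ⟨hzS, hz⟩ := mem_filter.1 hz
      by_contra hcon
      push Not at hcon
      refine hno z ((memT z).2 (Or.inr ⟨hzS, hcon.1, hcon.2, ?_⟩)) hz
      rintro rfl
      exact hvS (hcN v hz.symm)
    have hpriv : ∀ z, privates G S z = ∅ → nbrS G S v ≠ {z} := by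
      intro z hz h
      have : v ∈ privates G S z := by simp [privates, hvS, h]
      simp [hz] at this
    obtain ⟨z, hzS, hz⟩ := hdom v hvS
    have hzN : z ∈ nbrS G S v := mem_filter.2 ⟨hzS, hz⟩
    by_cases h1 : m a ∈ nbrS G S v
    · by_cases h2 : w ∈ nbrS G S v
      · have hN : nbrS G S v = {m a, w} := by
          ext t
          simp only [mem_insert, mem_singleton]
          constructor
          · exact hsub t
          · rintro (rfl | rfl) <;> assumption
        have hadj := (mem_filter.1 h1).2
        apply hf v hvS hadj
        have hD : nbrS G S v ⊆ setD G S m := by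
          rw [hN]; intro t ht
          simp only [mem_insert, mem_singleton] at ht
          rcases ht with rfl | rfl <;> assumption
        have hc2 : (nbrS G S v).card = 2 := by rw [hN]; exact card_pair hwb.symm
        unfold fwt
        rw [if_neg (by simp [hvS, hbS, hadj]), if_neg (hpriv _ hpb),
          if_pos (Or.inr (Or.inr hD)), hc2]
        norm_num
      · refine hpriv _ hpb (eq_singleton_iff_unique_mem.2 ⟨h1, fun t ht => ?_⟩)
        rcases hsub t ht with h | h
        · exact h
        · exact absurd (h ▸ ht) h2
    · have h2 : ∀ t ∈ nbrS G S v, t = w := fun t ht => by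
        rcases hsub t ht with h | h
        · exact absurd (h ▸ ht) h1
        · exact h
      exact hpriv _ hpw (eq_singleton_iff_unique_mem.2 ⟨h2 z hzN ▸ hzN, h2⟩)
  · have hay' : a ≠ y := hay.ne
    have haT : a ∈ T := (memT a).2 (Or.inr ⟨haS, hba.symm, hwa.symm, hca.symm⟩)
    refine ⟨fun v => if v = a then y else if v = y then a else m v, ?_⟩
    intro v hv
    by_cases hva : v = a
    · subst hva
      simp only [if_true, if_neg hay'.symm]
      exact ⟨(memT y).2 (Or.inl rfl), hay'.symm, hay, trivial⟩
    by_cases hvy : v = y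
    · subst hvy
      simp only [if_neg hva, if_true]
      exact ⟨haT, hay', hay.symm, trivial⟩
    obtain hv | ⟨hvS, hvb, hvw, hvc⟩ := (memT v).1 hv
    · exact absurd hv hvy
    obtain ⟨k1, k2, k3, k4⟩ := hmatch v hvS
    have n1 : m v ≠ a := fun h => hvb (by rw [← h, k4])
    have n2 : m v ≠ y := fun h => hy (h ▸ k1)
    simp only [if_neg hva, if_neg hvy, if_neg n1, if_neg n2]
    refine ⟨(memT _).2 (Or.inr ⟨k1, ?_, ?_, ?_⟩), k2, k3, k4⟩
    · intro h; exact hva (by rw [← k4, h, hmb])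
    · intro h; exact hvc (by rw [← k4, h])
    · intro h; exact hvw (by rw [← k4, h, hmc])

theorem degree_three_partner_no_constraint_pair {V : Type*} [Fintype V] [DecidableEq V]
    (G : SimpleGraph V) [DecidableRel G.Adj] (S : Finset V) (m : V → V)
    (hconn : G.Connected)
    (hcubic : ∀ v : V, G.degree v = 3)
    (hdom : ∀ v : V, v ∉ S → ∃ u ∈ S, G.Adj v u)
    (hmatch : IsMatchingOn G S m)
    (hmincard : ∀ T : Finset V, IsPDS G T → S.card ≤ T.card)
    (hP1 : ∀ T : Finset V, IsPDS G T → T.card = S.card → lambdaS G S ≤ lambdaS G T)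
    (hP2 : ∀ (T : Finset V) (m' : V → V),
        (∀ v : V, v ∉ T → ∃ u ∈ T, G.Adj v u) → IsMatchingOn G T m' →
        T.card = S.card → lambdaS G T = lambdaS G S →
        (setA G S m ∪ setB G S m).card ≤ (setA G T m' ∪ setB G T m').card) :
    ∀ u w₁ w₂ : V, u ∈ setD G S m → IsSoloPair G S m u →
      (∀ x : V, ¬ (G.Adj u x ∧ G.Adj (m u) x)) →
      (∀ x : V, x ∉ S → G.Adj x u → fwt G S m x u ≠ 1/2) →
      (∀ x : V, x ∉ S → G.Adj x (m u) → fwt G S m x (m u) ≠ 1/2) →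
      ((nbrS G S (m w₁)).card = 3 ∨ (nbrS G S (m w₂)).card = 3) →
      ¬ ConstraintPair G S m u w₁ w₂ := by
  intro u w₁ w₂ hu hsolo _ hfu hfb h3 ⟨x, y, hx, hy, huy, hbx, hxw, hyw, hw1, hw2, _, _⟩
  have huS : u ∈ S := (mem_filter.1 hu).1
  obtain ⟨-, hpu, hpb⟩ := mem_filter.1 hu
  obtain ⟨hbS, -, -, hmb⟩ := hmatch u huS
  rcases h3 with h3 | h3
  · have hbD : m u ∈ setD G S m := by
      simp only [setD, mem_filter]; exact ⟨hbS, hpb, by rw [hmb]; exact hpu⟩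
    exact one_sided_aux G S m hcubic hdom hmatch hmincard (m u) w₁ x hbD hsolo.2
      (by rw [hmb]; exact hsolo.1) (by rw [hmb]; exact hfu) hw1 h3 hx hbx hxw
  · exact one_sided_aux G S m hcubic hdom hmatch hmincard u w₂ y hu hsolo.1 hsolo.2
      hfb hw2 h3 hy huy hyw
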